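/- arXiv:1001.5069 — 2 statements merged into one kernel-verified Lean document; each statement's English description precedes it below -/
import Mathlib

section
/- Let G be a finite group of order N, M the minimal dimension of a nontrivial real irreducible representation of G, and A₁, A₂, A₃ subsets of G with |A₁||A₂||A₃| ≥ N³/M. Then A₁·A₂·A₃ = G. -/
open CategoryTheory Pointwise

namespace Representation

variable {G V : Type} [Group G] [AddCommGroup V] [Module ℝ V]

theorem simple_fdRep_of [FiniteDimensional ℝ V] (ρ : Representation ℝ G V) [ρ.IsIrreducible] :
    Simple (FDRep.of ρ) where
  mono_isIso_iff_nonzero := by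
    intro Y f _
    have hinj : Function.Injective f.hom.hom.hom :=
      (Rep.mono_iff_injective ((forget₂ (FDRep ℝ G) (Rep ℝ G)).map f)).1 inferInstance
    have hnt : Nontrivial V := by
      obtain ⟨σ, τ, hne⟩ := exists_pair_ne (Subrepresentation ρ)
      by_contra hV
      rw [not_nontrivial_iff_subsingleton] at hV
      exact hne (Subrepresentation.toSubmodule_injective (Subsingleton.elim _ _))
    have hcomm (g : G) (y : Y.V) : f.hom.hom.hom (Y.ρ g y) = ρ g (f.hom.hom.hom y) :=
      ConcreteCategory.congr_hom (f.comm g) y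
    constructor
    · rintro hiso rfl
      have hsurj : Function.Surjective (FDRep.isoToLinearEquiv (asIso (0 : Y ⟶ FDRep.of ρ))) :=
        LinearEquiv.surjective _
      obtain ⟨v, hv⟩ := exists_ne (0 : V)
      obtain ⟨y, hy⟩ := hsurj v
      exact hv hy.symm
    · intro hf
      let R : Subrepresentation ρ :=
        { toSubmodule := LinearMap.range f.hom.hom.hom
          apply_mem_toSubmodule := by
            rintro g _ ⟨y, rfl⟩
            exact ⟨Y.ρ g y, hcomm g y⟩ }
      have hR : R = ⊤ := by
        refine (eq_bot_or_eq_top R).resolve_left fun h => hf ?_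
        have h0 : LinearMap.range f.hom.hom.hom = ⊥ := congrArg Subrepresentation.toSubmodule h
        rw [LinearMap.range_eq_bot] at h0
        ext y
        exact LinearMap.congr_fun h0 y
      have hsurj : Function.Surjective f.hom.hom.hom :=
        LinearMap.range_eq_top.1 (congrArg Subrepresentation.toSubmodule hR)
      have : IsIso f.hom :=
        (LinearEquiv.ofBijective f.hom.hom.hom ⟨hinj, hsurj⟩).toFGModuleCatIso.isIso_hom
      exact Action.isIso_of_hom_isIso f

theorem exists_isIrreducible_le [FiniteDimensional ℝ V] (ρ : Representation ℝ G V)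
    (W : Subrepresentation ρ) (hW : W.toSubmodule ≠ ⊥) :
    ∃ U : Subrepresentation ρ, U ≤ W ∧ U.toRepresentation.IsIrreducible := by
  obtain ⟨U, ⟨hUW, hU⟩, hmin⟩ := exists_minimalFor_of_wellFoundedLT
    (fun U : Subrepresentation ρ => U ≤ W ∧ U.toSubmodule ≠ ⊥)
    (fun U => Module.finrank ℝ U.toSubmodule) ⟨W, le_rfl, hW⟩
  refine ⟨U, hUW, ?_⟩
  refine { exists_pair_ne := ⟨⊥, ⊤, ?_⟩, eq_bot_or_eq_top := ?_ }
  · intro h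
    have h' : (⊥ : Submodule ℝ U.toSubmodule) = ⊤ := congrArg Subrepresentation.toSubmodule h
    have := Submodule.subsingleton_iff ℝ |>.1 (subsingleton_of_bot_eq_top h')
    exact hU (Submodule.eq_bot_of_subsingleton)
  · intro τ
    refine or_iff_not_imp_left.2 fun hτ => ?_
    have hτ' : τ.toSubmodule ≠ ⊥ := fun h => hτ (Subrepresentation.toSubmodule_injective h)
    let σ : Subrepresentation ρ :=
      { toSubmodule := τ.toSubmodule.map U.toSubmodule.subtype
        apply_mem_toSubmodule := by
          rintro g _ ⟨v, hv, rfl⟩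
          exact ⟨_, τ.apply_mem_toSubmodule g hv, rfl⟩ }
    have hσU : σ.toSubmodule ≤ U.toSubmodule := Submodule.map_subtype_le _ _
    have hσ : σ.toSubmodule ≠ ⊥ := by
      intro h
      exact hτ' (Submodule.map_injective_of_injective (Submodule.subtype_injective _)
        (h.trans (Submodule.map_bot _).symm))
    have hle := hmin (j := σ) ⟨fun v hv => hUW (hσU hv), hσ⟩ (Submodule.finrank_mono hσU)
    have heq : Module.finrank ℝ σ.toSubmodule = Module.finrank ℝ τ.toSubmodule :=
      Submodule.finrank_map_subtype_eq _ _
    apply Subrepresentation.toSubmodule_injective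
    apply Submodule.eq_top_of_finrank_eq
    apply le_antisymm (Submodule.finrank_le _)
    rw [← heq]
    exact hle

theorem le_finrank_of_forall_simple {M : ℕ}
    (hM : ∀ V : FDRep ℝ G, Simple V → (∃ g : G, V.ρ g ≠ 1) → M ≤ Module.finrank ℝ V)
    [FiniteDimensional ℝ V] (ρ : Representation ℝ G V) (W : Subrepresentation ρ)
    (hW : W.toSubmodule ≠ ⊥) (hinv : ∀ v ∈ W, (∀ g, ρ g v = v) → v = 0) :
    M ≤ Module.finrank ℝ W.toSubmodule := by
  obtain ⟨U, hUW, hU⟩ := exists_isIrreducible_le ρ W hW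
  refine (hM (FDRep.of U.toRepresentation) (simple_fdRep_of _) ?_).trans
    (Submodule.finrank_mono hUW)
  by_contra! h
  obtain ⟨σ, τ, hne⟩ := exists_pair_ne (Subrepresentation U.toRepresentation)
  have hsub : Subsingleton U.toSubmodule := by
    refine subsingleton_of_forall_eq 0 fun v => Subtype.ext (hinv v (hUW v.2) fun g => ?_)
    exact congrArg Subtype.val (LinearMap.congr_fun (h g) v)
  exact hne (Subrepresentation.toSubmodule_injective (Subsingleton.elim _ _))

end Representation

section HilbertSchmidt

variable {E : Type} [NormedAddCommGroup E] [InnerProductSpace ℝ E] [FiniteDimensional ℝ E]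

theorem LinearMap.exists_eigenvalue_adjoint_comp_self [Nontrivial E] (T : E →ₗ[ℝ] E) :
    ∃ μ : ℝ, Module.End.HasEigenvalue (T.adjoint ∘ₗ T) μ ∧ ∀ v, ‖T v‖ ^ 2 ≤ μ * ‖v‖ ^ 2 := by
  have hinner (v : E) : inner ℝ ((T.adjoint ∘ₗ T) v) v = ‖T v‖ ^ 2 := by
    rw [LinearMap.comp_apply, LinearMap.adjoint_inner_left, real_inner_self_eq_norm_sq]
  have hsymm : (T.adjoint ∘ₗ T).IsSymmetric := T.isSymmetric_adjoint_mul_self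
  refine ⟨_, hsymm.hasEigenvalue_iSup_of_finiteDimensional, fun v => ?_⟩
  rcases eq_or_ne v 0 with rfl | hv
  · simp
  rw [← div_le_iff₀ (by positivity)]
  refine le_ciSup_of_le ?_ (⟨v, hv⟩ : {x : E // x ≠ 0}) (by simp [-LinearMap.coe_comp, hinner])
  refine ⟨‖LinearMap.toContinuousLinearMap T‖ ^ 2, ?_⟩
  rintro _ ⟨⟨x, hx⟩, rfl⟩
  simp only [hinner, RCLike.re_to_real]
  rw [div_le_iff₀ (by positivity), ← mul_pow]
  gcongr
  exact (LinearMap.toContinuousLinearMap T).le_opNorm x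

theorem Orthonormal.sum_norm_sq_map_le {ι κ : Type} [Fintype ι] [Fintype κ] {b : ι → E}
    (hb : Orthonormal ℝ b) (e : OrthonormalBasis κ ℝ E) (T : E →ₗ[ℝ] E) :
    ∑ i, ‖T (b i)‖ ^ 2 ≤ ∑ k, ‖T.adjoint (e k)‖ ^ 2 := by
  calc ∑ i, ‖T (b i)‖ ^ 2 = ∑ i, ∑ k, ‖inner ℝ (b i) (T.adjoint (e k))‖ ^ 2 := by
        simp_rw [LinearMap.adjoint_inner_right, e.sum_sq_norm_inner_left]
    _ = ∑ k, ∑ i, ‖inner ℝ (b i) (T.adjoint (e k))‖ ^ 2 := Finset.sum_comm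
    _ ≤ _ := Finset.sum_le_sum fun k _ => hb.sum_inner_products_le _

/-- If a linear map intertwines an orthogonal representation with itself and kills the invariant
vectors, its operator norm is controlled by its Hilbert–Schmidt norm and the minimal degree of a
nontrivial irreducible representation. -/
theorem Representation.mul_norm_sq_map_le {G κ : Type} [Group G] [Fintype κ] {M : ℕ}
    (hM : ∀ V : FDRep ℝ G, Simple V → (∃ g : G, V.ρ g ≠ 1) → M ≤ Module.finrank ℝ V)
    (ρ : Representation ℝ G E) (hρ : ∀ g v w, inner ℝ (ρ g v) (ρ g w) = inner ℝ v w)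
    (T : E →ₗ[ℝ] E) (hT : ∀ g v, T (ρ g v) = ρ g (T v))
    (hinv : ∀ v, (∀ g, ρ g v = v) → T v = 0) (e : OrthonormalBasis κ ℝ E) (v : E) :
    M * ‖T v‖ ^ 2 ≤ (∑ k, ‖T.adjoint (e k)‖ ^ 2) * ‖v‖ ^ 2 := by
  rcases subsingleton_or_nontrivial E with hE | hE
  · simp [Subsingleton.elim v 0]
  obtain ⟨μ, hμ, hle⟩ := T.exists_eigenvalue_adjoint_comp_self
  suffices h : M * μ ≤ ∑ k, ‖T.adjoint (e k)‖ ^ 2 by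
    calc M * ‖T v‖ ^ 2 ≤ M * (μ * ‖v‖ ^ 2) := by gcongr; exact hle v
      _ = M * μ * ‖v‖ ^ 2 := by ring
      _ ≤ _ := by gcongr
  have hpos : 0 ≤ ∑ k, ‖T.adjoint (e k)‖ ^ 2 := by positivity
  rcases le_or_gt μ 0 with hμ0 | hμ0
  · exact (mul_nonpos_of_nonneg_of_nonpos (by positivity) hμ0).trans hpos
  have hcomm (g : G) (v : E) : T.adjoint (T (ρ g v)) = ρ g (T.adjoint (T v)) := by
    refine ext_inner_right ℝ fun w => ?_
    have hw : ρ g (ρ g⁻¹ w) = w := by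
      rw [← Module.End.mul_apply, ← map_mul, mul_inv_cancel, map_one, Module.End.one_apply]
    rw [← hw, hρ, LinearMap.adjoint_inner_left, LinearMap.adjoint_inner_left, hT, hT, hρ]
  have hmem {v : E} : v ∈ Module.End.eigenspace (T.adjoint ∘ₗ T) μ ↔ T.adjoint (T v) = μ • v :=
    Module.End.mem_eigenspace_iff
  let W : Subrepresentation ρ :=
    { toSubmodule := Module.End.eigenspace (T.adjoint ∘ₗ T) μ
      apply_mem_toSubmodule := by
        intro g v hv
        rw [hmem] at hv ⊢
        rw [hcomm, hv, map_smul] }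
  have hfin : M ≤ Module.finrank ℝ W.toSubmodule := by
    refine Representation.le_finrank_of_forall_simple hM ρ W hμ fun v hv hfix => ?_
    have h := hmem.1 hv
    rw [hinv v hfix, map_zero] at h
    exact (smul_eq_zero.1 h.symm).resolve_left hμ0.ne'
  let b := stdOrthonormalBasis ℝ W.toSubmodule
  have hb : Orthonormal ℝ fun i => (b i : E) :=
    b.orthonormal.comp_linearIsometry W.toSubmodule.subtypeₗᵢ
  have hnorm (i) : ‖T (b i : E)‖ ^ 2 = μ := by
    have h := hmem.1 (b i).2
    rw [← real_inner_self_eq_norm_sq, ← LinearMap.adjoint_inner_left, h, inner_smul_left,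
      real_inner_self_eq_norm_sq, hb.1 i]
    simp
  calc (M : ℝ) * μ ≤ Module.finrank ℝ W.toSubmodule * μ := by gcongr
    _ = ∑ i, ‖T (b i : E)‖ ^ 2 := by simp [hnorm]
    _ ≤ _ := hb.sum_norm_sq_map_le e T

end HilbertSchmidt

section Convolution

variable {G : Type} [Fintype G]

/-- The indicator function of `A`. -/
noncomputable def finsetIndicator [DecidableEq G] (A : Finset G) : EuclideanSpace ℝ G :=
  WithLp.toLp 2 fun x => if x ∈ A then 1 else 0

theorem norm_sq_finsetIndicator [DecidableEq G] (A : Finset G) : ‖finsetIndicator A‖ ^ 2 = A.card := by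
  simp [EuclideanSpace.norm_sq_eq, finsetIndicator, apply_ite]

variable [Group G]

/-- Right translation of functions on `G`. -/
noncomputable def rightRegular (G : Type) [Group G] [Fintype G] :
    Representation ℝ G (EuclideanSpace ℝ G) where
  toFun g := (LinearIsometryEquiv.piLpCongrLeft 2 ℝ ℝ (Equiv.mulRight g⁻¹)).toLinearMap
  map_one' := by
    ext f x
    exact congrArg f (by simp [Equiv.symm_apply_eq])
  map_mul' g h := by
    ext f x
    exact congrArg f (by simp [Equiv.symm_apply_eq, mul_assoc])

theorem rightRegular_apply (g x : G) (f : EuclideanSpace ℝ G) :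
    rightRegular G g f x = f (x * g) := by
  simp [rightRegular]

/-- Left convolution by the function `k`. -/
noncomputable def leftConvolution [DecidableEq G] (k : G → ℝ) :
    EuclideanSpace ℝ G →ₗ[ℝ] EuclideanSpace ℝ G :=
  Matrix.toEuclideanLin (Matrix.of fun x y => k (x * y⁻¹))

variable [DecidableEq G]

theorem leftConvolution_apply (k : G → ℝ) (f : EuclideanSpace ℝ G) (x : G) :
    leftConvolution k f x = ∑ y, k (x * y⁻¹) * f y := by
  simp [leftConvolution, Matrix.toLpLin_apply, Matrix.mulVec, dotProduct]

theorem sum_norm_sq_adjoint_leftConvolution (k : G → ℝ) :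
    ∑ x, ‖(leftConvolution k).adjoint (EuclideanSpace.basisFun G ℝ x)‖ ^ 2 =
      Fintype.card G * ∑ z, k z ^ 2 := by
  have h (x : G) : ‖(leftConvolution k).adjoint (EuclideanSpace.basisFun G ℝ x)‖ ^ 2 =
      ∑ z, k z ^ 2 := by
    rw [← (EuclideanSpace.basisFun G ℝ).sum_sq_norm_inner_left]
    refine Fintype.sum_equiv ((Equiv.inv G).trans (Equiv.mulLeft x)) _ _ fun y => ?_
    rw [LinearMap.adjoint_inner_left]
    simp [leftConvolution_apply, EuclideanSpace.inner_single_left]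
  simp only [h, Finset.sum_const, Finset.card_univ, nsmul_eq_mul]

theorem mul_norm_sq_leftConvolution_le {M : ℕ}
    (hM : ∀ V : FDRep ℝ G, Simple V → (∃ g : G, V.ρ g ≠ 1) → M ≤ Module.finrank ℝ V)
    (k : G → ℝ) (hk : ∑ z, k z = 0) (f : EuclideanSpace ℝ G) :
    M * ‖leftConvolution k f‖ ^ 2 ≤ (Fintype.card G * ∑ z, k z ^ 2) * ‖f‖ ^ 2 := by
  rw [← sum_norm_sq_adjoint_leftConvolution]
  refine (rightRegular G).mul_norm_sq_map_le hM ?_ _ ?_ ?_ _ f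
  · intro g v w
    exact (LinearIsometryEquiv.piLpCongrLeft 2 ℝ ℝ (Equiv.mulRight g⁻¹)).inner_map_map v w
  · intro g v
    ext x
    simp only [leftConvolution_apply, rightRegular_apply]
    exact Fintype.sum_equiv (Equiv.mulRight g) _ _ fun y => by simp [mul_assoc]
  · intro v hv
    have hconst (y : G) : v y = v 1 := by
      have := rightRegular_apply y 1 v
      rwa [hv, one_mul, eq_comm] at this
    ext x
    simp only [leftConvolution_apply, hconst, ← Finset.sum_mul, PiLp.zero_apply]
    have : ∑ y, k (x * y⁻¹) = ∑ z, k z :=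
      Fintype.sum_equiv ((Equiv.inv G).trans (Equiv.mulLeft x)) _ _ fun y => by simp
    rw [this, hk, zero_mul]

/-- The indicator function of `A` minus its mean. -/
noncomputable def balancedIndicator (A : Finset G) (x : G) : ℝ :=
  (if x ∈ A then 1 else 0) - A.card / Fintype.card G

theorem sum_balancedIndicator (A : Finset G) : ∑ x, balancedIndicator A x = 0 := by
  have : (Fintype.card G : ℝ) ≠ 0 := by simp
  simp [balancedIndicator, mul_div_cancel₀ _ this]

theorem card_mul_sum_balancedIndicator_sq (A : Finset G) :
    Fintype.card G * ∑ x, balancedIndicator A x ^ 2 = A.card * (Fintype.card G - A.card) := by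
  have hN : (Fintype.card G : ℝ) ≠ 0 := by simp
  have h (x : G) : balancedIndicator A x ^ 2 =
      (if x ∈ A then 1 else 0) * (1 - 2 * (A.card / Fintype.card G : ℝ))
        + (A.card / Fintype.card G : ℝ) ^ 2 := by
    unfold balancedIndicator
    split_ifs <;> ring
  simp only [h, Finset.sum_add_distrib, ← Finset.sum_mul]
  simp
  field_simp
  ring

theorem inner_leftConvolution_balancedIndicator {A B C : Finset G}
    (h : ∀ a ∈ A, ∀ b ∈ B, a * b ∉ C) :
    inner ℝ (finsetIndicator C) (leftConvolution (balancedIndicator A) (finsetIndicator B)) =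
      -(A.card * B.card * C.card / Fintype.card G : ℝ) := by
  have hx (x : G) (hx : x ∈ C) : leftConvolution (balancedIndicator A) (finsetIndicator B) x =
      -(A.card * B.card / Fintype.card G : ℝ) := by
    rw [leftConvolution_apply]
    have hy (y : G) : balancedIndicator A (x * y⁻¹) * finsetIndicator B y =
        if y ∈ B then -(A.card / Fintype.card G : ℝ) else 0 := by
      by_cases hyB : y ∈ B
      · have hA : x * y⁻¹ ∉ A := fun hA => h _ hA _ hyB (by simpa using hx)
        simp [balancedIndicator, finsetIndicator, hyB, hA]
      · simp [finsetIndicator, hyB]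
    simp [hy]
    ring
  have hsum : inner ℝ (finsetIndicator C)
      (leftConvolution (balancedIndicator A) (finsetIndicator B)) =
      ∑ x, if x ∈ C then -(A.card * B.card / Fintype.card G : ℝ) else 0 := by
    rw [PiLp.inner_apply]
    refine Finset.sum_congr rfl fun x _ => ?_
    by_cases hxC : x ∈ C
    · rw [hx x hxC]
      simp [finsetIndicator, hxC]
    · simp [finsetIndicator, hxC]
  rw [hsum]
  simp
  ring

theorem mul_card_mul_card_mul_card_le {M : ℕ}
    (hM : ∀ V : FDRep ℝ G, Simple V → (∃ g : G, V.ρ g ≠ 1) → M ≤ Module.finrank ℝ V)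
    {A B C : Finset G} (hA : A.Nonempty) (hB : B.Nonempty) (hC : C.Nonempty)
    (h : ∀ a ∈ A, ∀ b ∈ B, a * b ∉ C) :
    (M * (A.card * B.card * C.card) : ℝ) ≤
      Fintype.card G ^ 2 * (Fintype.card G - A.card) := by
  have hN : (0 : ℝ) < Fintype.card G := by exact_mod_cast Fintype.card_pos
  have hA' : (0 : ℝ) < A.card := by exact_mod_cast hA.card_pos
  have hB' : (0 : ℝ) < B.card := by exact_mod_cast hB.card_pos
  have hC' : (0 : ℝ) < C.card := by exact_mod_cast hC.card_pos
  have hop := mul_norm_sq_leftConvolution_le hM _ (sum_balancedIndicator A) (finsetIndicator B)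
  rw [card_mul_sum_balancedIndicator_sq, norm_sq_finsetIndicator] at hop
  have hcs := abs_real_inner_le_norm (finsetIndicator C)
    (leftConvolution (balancedIndicator A) (finsetIndicator B))
  rw [inner_leftConvolution_balancedIndicator h, abs_neg, abs_of_pos (by positivity)] at hcs
  have hsq := pow_le_pow_left₀ (by positivity) hcs 2
  rw [mul_pow, norm_sq_finsetIndicator] at hsq
  have key : (M : ℝ) * (A.card * B.card * C.card / Fintype.card G : ℝ) ^ 2 ≤
      C.card * (A.card * (Fintype.card G - A.card) * B.card) := by
    calc _ ≤ (M : ℝ) * (C.card *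
          ‖leftConvolution (balancedIndicator A) (finsetIndicator B)‖ ^ 2) := by gcongr
      _ = C.card * (M * ‖leftConvolution (balancedIndicator A) (finsetIndicator B)‖ ^ 2) := by
        ring
      _ ≤ _ := by gcongr
  rw [div_pow, mul_div_assoc', div_le_iff₀ (by positivity)] at key
  refine le_of_mul_le_mul_left ?_ (show (0 : ℝ) < A.card * B.card * C.card by positivity)
  linarith

end Convolution

theorem stmt_11 {G : Type} [Group G] [Fintype G] [DecidableEq G]
    (N : ℕ) (hN : N = Fintype.card G)
    (M : ℕ)
    (hM_le : ∀ V : FDRep ℝ G, Simple V → (∃ g : G, V.ρ g ≠ 1) → M ≤ Module.finrank ℝ V)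
    (hM_mem : ∃ V : FDRep ℝ G, Simple V ∧ (∃ g : G, V.ρ g ≠ 1) ∧ Module.finrank ℝ V = M)
    (A₁ A₂ A₃ : Finset G)
    (h : (N : ℝ) ^ 3 / M ≤ (A₁.card : ℝ) * A₂.card * A₃.card) :
    A₁ * A₂ * A₃ = Finset.univ := by
  have hMpos : (0 : ℝ) < M := by
    obtain ⟨V, -, ⟨g, hg⟩, rfl⟩ := hM_mem
    rw [Nat.cast_pos, Module.finrank_pos_iff]
    by_contra hV
    rw [not_nontrivial_iff_subsingleton] at hV
    exact hg (LinearMap.ext fun v => Subsingleton.elim _ _)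
  have hNpos : (0 : ℝ) < N := by
    rw [hN]
    exact_mod_cast Fintype.card_pos
  have hpos : (0 : ℝ) < (A₁.card : ℝ) * A₂.card * A₃.card := lt_of_lt_of_le (by positivity) h
  have h₁ : A₁.Nonempty := Finset.nonempty_iff_ne_empty.2 (by rintro rfl; simp at hpos)
  have h₂ : A₂.Nonempty := Finset.nonempty_iff_ne_empty.2 (by rintro rfl; simp at hpos)
  have h₃ : A₃.Nonempty := Finset.nonempty_iff_ne_empty.2 (by rintro rfl; simp at hpos)
  refine Finset.eq_univ_iff_forall.2 fun g => ?_
  by_contra hg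
  have hcard : (A₁.image fun a => a⁻¹ * g).card = A₁.card :=
    Finset.card_image_of_injective _ fun a b hab => by simpa using hab
  have hle := mul_card_mul_card_mul_card_le hM_le h₂ h₃ (h₁.image fun a => a⁻¹ * g) (by
    intro b hb c hc hbc
    obtain ⟨a, ha, hab⟩ := Finset.mem_image.1 hbc
    refine hg ?_
    have : g = a * b * c := by rw [mul_assoc, ← hab, mul_inv_cancel_left]
    rw [this]
    exact Finset.mul_mem_mul (Finset.mul_mem_mul ha hb) hc)
  rw [hcard, ← hN] at hle
  rw [div_le_iff₀ hMpos] at h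
  have h₂' : (0 : ℝ) < A₂.card := by exact_mod_cast h₂.card_pos
  have : (0 : ℝ) < N ^ 2 * A₂.card := by positivity
  linarith
end

section
/- Let F be a field, G = SL₂(F), and A a finite subset of G such that the subgroup generated by A is non-abelian. Then the set of words of length at most 3 in A ∪ A⁻¹ ∪ {1} contains at least |A|/4 semisimple elements, i.e. elements g with Tr(g) ≠ ±2. -/
open Pointwise

namespace SLTwo

variable {F : Type*} [Field F]

local notation "SL₂" => Matrix.SpecialLinearGroup (Fin 2)

/-- The trace of an element of `SL₂(F)`. -/
def tr (g : SL₂ F) : F := Matrix.trace g.val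

/-- Semisimplicity in the sense `tr g ≠ ±2`. -/
def Semisimple (g : SL₂ F) : Prop := tr g ≠ 2 ∧ tr g ≠ -2

lemma tr_eq (g : SL₂ F) : tr g = g.val 0 0 + g.val 1 1 := Matrix.trace_fin_two _

lemma det_eq (g : SL₂ F) : g.val 0 0 * g.val 1 1 - g.val 0 1 * g.val 1 0 = 1 := by
  rw [← Matrix.det_fin_two]
  exact g.2

lemma tr_mul (g h : SL₂ F) : tr (g * h) =
    g.val 0 0 * h.val 0 0 + g.val 0 1 * h.val 1 0 +
      (g.val 1 0 * h.val 0 1 + g.val 1 1 * h.val 1 1) := by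
  simp [tr, Matrix.trace_fin_two, Matrix.mul_apply, Fin.sum_univ_two]

lemma tr_one : tr (1 : SL₂ F) = 2 := by
  simp [tr]

lemma tr_comm (g h : SL₂ F) : tr (g * h) = tr (h * g) := by
  rw [tr_mul, tr_mul]
  ring

lemma tr_inv (g : SL₂ F) : tr g⁻¹ = tr g := by
  rw [tr, Matrix.SpecialLinearGroup.coe_inv, Matrix.adjugate_fin_two, tr_eq]
  simp [Matrix.trace_fin_two, add_comm]

lemma tr_mul_inv (g h : SL₂ F) : tr (g * h⁻¹) = tr g * tr h - tr (g * h) := by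
  rw [tr_mul, tr_mul, tr_eq, tr_eq, Matrix.SpecialLinearGroup.coe_inv, Matrix.adjugate_fin_two]
  simp
  ring

lemma tr_conj (g h : SL₂ F) : tr (g * h * g⁻¹) = tr h := by
  rw [tr_comm, inv_mul_cancel_left]

lemma tr_mul_self (g : SL₂ F) : tr (g * g) = tr g ^ 2 - 2 := by
  have h := tr_mul_inv g g
  rw [mul_inv_cancel, tr_one] at h
  linear_combination h

lemma not_semisimple_iff {g : SL₂ F} : ¬ Semisimple g ↔ ∃ ε : F, ε ^ 2 = 1 ∧ tr g = 2 * ε := by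
  constructor
  · intro h
    by_cases h1 : tr g = 2
    · exact ⟨1, by ring, by rw [h1]; ring⟩
    · have : tr g = -2 := by
        by_contra h3
        exact h ⟨h1, h3⟩
      exact ⟨-1, by ring, by rw [this]; ring⟩
  · rintro ⟨ε, hε, h⟩ ⟨h1, h2⟩
    rcases sq_eq_one_iff.mp hε with rfl | rfl
    · exact h1 (by rw [h]; ring)
    · exact h2 (by rw [h]; ring)

lemma mul_comm_iff (a u : SL₂ F) : a * u = u * a ↔
    a.val 0 1 * u.val 1 0 = u.val 0 1 * a.val 1 0 ∧
    (a.val 0 0 - a.val 1 1) * u.val 0 1 = (u.val 0 0 - u.val 1 1) * a.val 0 1 ∧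
    (a.val 0 0 - a.val 1 1) * u.val 1 0 = (u.val 0 0 - u.val 1 1) * a.val 1 0 := by
  constructor
  · intro h
    have e (i j : Fin 2) : (a * u).val i j = (u * a).val i j := by rw [h]
    have e0 := e 0 0
    have e1 := e 0 1
    have e2 := e 1 0
    simp only [Matrix.SpecialLinearGroup.coe_mul, Matrix.mul_apply, Fin.sum_univ_two] at e0 e1 e2
    refine ⟨?_, ?_, ?_⟩
    · linear_combination e0
    · linear_combination e1
    · linear_combination -e2
  · rintro ⟨h0, h1, h2⟩
    ext i j
    fin_cases i <;> fin_cases j <;>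
      simp only [Matrix.SpecialLinearGroup.coe_mul, Matrix.mul_apply, Fin.sum_univ_two,
        Fin.zero_eta, Fin.mk_one, Fin.isValue]
    · linear_combination h0
    · linear_combination h1
    · linear_combination -h2
    · linear_combination -h0

/-- Two elements of trace `±2` whose product has the trace of a reducible pair commute. -/
lemma mul_comm_of_tr {a u : SL₂ F} {ε δ : F} (hε : ε ^ 2 = 1) (hδ : δ ^ 2 = 1)
    (ha : tr a = 2 * ε) (hu : tr u = 2 * δ) (hau : tr (a * u) = 2 * (ε * δ)) :
    a * u = u * a := by
  have da := det_eq a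
  have du := det_eq u
  rw [tr_eq] at ha hu
  rw [tr_mul] at hau
  rw [mul_comm_iff]
  generalize a.val 0 0 = a0, a.val 0 1 = a1, a.val 1 0 = a2, a.val 1 1 = a3 at *
  generalize u.val 0 0 = u0, u.val 0 1 = u1, u.val 1 0 = u2, u.val 1 1 = u3 at *
  obtain ⟨S, rfl⟩ : ∃ S, a0 = ε + S := ⟨a0 - ε, by ring⟩
  obtain ⟨P, rfl⟩ : ∃ P, u0 = δ + P := ⟨u0 - δ, by ring⟩
  obtain rfl : a3 = ε - S := by linear_combination ha
  obtain rfl : u3 = δ - P := by linear_combination hu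
  have hS : a1 * a2 = - S ^ 2 := by linear_combination hε - da
  have hP : u1 * u2 = - P ^ 2 := by linear_combination hδ - du
  have hm : a1 * u2 + a2 * u1 = - (2 * P * S) := by linear_combination hau
  have k1 : S * u1 = P * a1 := by
    rw [← sub_eq_zero, ← sq_eq_zero_iff]
    linear_combination u1 ^ 2 * hS + a1 ^ 2 * hP - a1 * u1 * hm
  have k2 : S * u2 = P * a2 := by
    rw [← sub_eq_zero, ← sq_eq_zero_iff]
    linear_combination u2 ^ 2 * hS + a2 ^ 2 * hP - a2 * u2 * hm
  refine ⟨?_, ?_, ?_⟩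
  · rw [← sub_eq_zero, ← sq_eq_zero_iff]
    linear_combination (a1 * u2 + a2 * u1 - 2 * P * S) * hm - 4 * u1 * u2 * hS + 4 * S ^ 2 * hP
  · linear_combination 2 * k1
  · linear_combination 2 * k2

/-- In characteristic not two, two non-semisimple elements either commute or one of their
quotients and products is semisimple. -/
lemma semisimple_mul_or {a u : SL₂ F} (h2 : (2 : F) ≠ 0) (ha : ¬ Semisimple a)
    (hu : ¬ Semisimple u) (h : a * u ≠ u * a) :
    Semisimple (a * u) ∨ Semisimple (a * u⁻¹) := by
  by_contra! hc
  obtain ⟨h1, h3⟩ := hc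
  rw [not_semisimple_iff] at ha hu h1 h3
  obtain ⟨ε, hε, ha⟩ := ha
  obtain ⟨δ, hδ, hu⟩ := hu
  obtain ⟨μ, hμ, h1⟩ := h1
  obtain ⟨ν, hν, h3⟩ := h3
  rw [tr_mul_inv, ha, hu, h1] at h3
  have h3 : 2 * (ε * δ) = μ + ν := mul_left_cancel₀ h2 (by linear_combination h3)
  have hμν : μ * ν = 1 := mul_left_cancel₀ h2 (by
    linear_combination (-(2 * (ε * δ)) - μ - ν) * h3 - hμ - hν + 4 * δ ^ 2 * hε + 4 * hδ)
  obtain rfl : ν = μ := by linear_combination μ * hμν - ν * hμ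
  refine h (mul_comm_of_tr hε hδ ha hu ?_)
  rw [h1]
  linear_combination -h3

/-- In characteristic not two, an element `r` of trace other than `0, ±2` moves every
non-semisimple element to a semisimple one, by multiplication by `r` or by `r⁻¹`. -/
lemma tr_eq_zero_of_mul {a r : SL₂ F} (h2 : (2 : F) ≠ 0) (hr : Semisimple r)
    (ha : ¬ Semisimple a) (h1 : ¬ Semisimple (a * r)) (h3 : ¬ Semisimple (a * r⁻¹)) :
    tr r = 0 := by
  by_contra h0
  rw [not_semisimple_iff] at ha h1 h3
  obtain ⟨ε, hε, ha⟩ := ha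
  obtain ⟨μ, hμ, h1⟩ := h1
  obtain ⟨ν, hν, h3⟩ := h3
  rw [tr_mul_inv, ha, h1] at h3
  have h3 : ε * tr r = μ + ν := mul_left_cancel₀ h2 (by linear_combination h3)
  have key : tr r ^ 2 * (tr r ^ 2 - 4) = 0 := by
    have : tr r ^ 2 = 2 + 2 * (μ * ν) := by
      linear_combination (ε * tr r + μ + ν) * h3 - tr r ^ 2 * hε + hμ + hν
    rw [this]
    linear_combination 4 * ν ^ 2 * hμ + 4 * hν
  rcases mul_eq_zero.mp key with h | h
  · exact h0 (by simpa using h)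
  · have h : (tr r - 2) * (tr r + 2) = 0 := by linear_combination h
    rcases mul_eq_zero.mp h with h | h
    · exact hr.1 (by linear_combination h)
    · exact hr.2 (by linear_combination h)

lemma exists_eq_smul_one_add_smul {x e : SL₂ F} (h1 : e ≠ 1) (h1' : e ≠ -1)
    (h : x * e = e * x) : ∃ s t : F, x.val = s • (1 : Matrix (Fin 2) (Fin 2) F) + t • e.val := by
  rw [mul_comm_iff] at h
  obtain ⟨k0, k1, k2⟩ := h
  have build (t : F) (e0 : x.val 0 0 - x.val 1 1 = t * (e.val 0 0 - e.val 1 1))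
      (e1 : x.val 0 1 = t * e.val 0 1) (e2 : x.val 1 0 = t * e.val 1 0) :
      ∃ s t : F, x.val = s • (1 : Matrix (Fin 2) (Fin 2) F) + t • e.val := by
    refine ⟨x.val 0 0 - t * e.val 0 0, t, ?_⟩
    ext i j
    fin_cases i <;> fin_cases j <;> simp [e1, e2]
    linear_combination -e0
  by_cases n1 : e.val 0 1 = 0
  · by_cases n2 : e.val 1 0 = 0
    · by_cases n3 : e.val 0 0 - e.val 1 1 = 0
      · exfalso
        have d := det_eq e
        have n3 : e.val 1 1 = e.val 0 0 := by linear_combination -n3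
        rw [n1, n3] at d
        have hs : e.val 0 0 ^ 2 = 1 := by linear_combination d
        rcases sq_eq_one_iff.mp hs with hs | hs
        · apply h1
          ext i j
          fin_cases i <;> fin_cases j <;> simp [n1, n2, n3, hs]
        · apply h1'
          ext i j
          fin_cases i <;> fin_cases j <;> simp [n1, n2, n3, hs]
      · refine build ((x.val 0 0 - x.val 1 1) / (e.val 0 0 - e.val 1 1)) ?_ ?_ ?_ <;>
          field_simp
        · linear_combination -k1
        · linear_combination -k2
    · refine build (x.val 1 0 / e.val 1 0) ?_ ?_ ?_ <;> field_simp
      · linear_combination k2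
      · linear_combination k0
  · refine build (x.val 0 1 / e.val 0 1) ?_ ?_ ?_ <;> field_simp
    · linear_combination k1
    · linear_combination -k0

lemma mul_comm_of_centralize {x y e : SL₂ F} (h1 : e ≠ 1) (h1' : e ≠ -1)
    (hx : x * e = e * x) (hy : y * e = e * y) : x * y = y * x := by
  obtain ⟨s, t, hx⟩ := exists_eq_smul_one_add_smul h1 h1' hx
  obtain ⟨s', t', hy⟩ := exists_eq_smul_one_add_smul h1 h1' hy
  apply Subtype.ext
  simp only [Matrix.SpecialLinearGroup.coe_mul, hx, hy]
  simp only [add_mul, mul_add, smul_mul_assoc, mul_smul_comm, one_mul, mul_one]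
  module

/-- An element commuting with the `±`-unipotent `u` is `α + β (u - δ)`, seen through traces. -/
lemma exists_param {a u : SL₂ F} {δ : F} (h2 : (2 : F) ≠ 0) (h1 : u ≠ 1) (h1' : u ≠ -1)
    (hu : tr u = 2 * δ) (ha : ¬ Semisimple a) (h : a * u = u * a) :
    ∃ α β : F, α ^ 2 = 1 ∧ tr a = 2 * α ∧
      a.val = (α - δ * β) • (1 : Matrix (Fin 2) (Fin 2) F) + β • u.val ∧
      ∀ g, tr (a * g) = α * tr g + β * (tr (u * g) - δ * tr g) := by
  obtain ⟨s, t, hst⟩ := exists_eq_smul_one_add_smul h1 h1' h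
  have htr (g : SL₂ F) : tr (a * g) = s * tr g + t * tr (u * g) := by
    simp only [tr, Matrix.SpecialLinearGroup.coe_mul, hst, add_mul, smul_mul_assoc, one_mul,
      Matrix.trace_add, Matrix.trace_smul, smul_eq_mul]
  have h0 := htr 1
  rw [mul_one, mul_one, tr_one, hu] at h0
  obtain ⟨ε, hε, ha⟩ := not_semisimple_iff.mp ha
  obtain rfl : ε = s + δ * t := mul_left_cancel₀ h2 (by linear_combination h0 - ha)
  refine ⟨s + δ * t, t, hε, ha, ?_, fun g => ?_⟩
  · rw [hst]
    congr 2
    ring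
  · rw [htr]
    ring

open Classical in
lemma card_le_of_translates (A B : Finset (SL₂ F)) (t : Fin 4 → SL₂ F)
    (h : ∀ a ∈ A, ∃ i, a * t i ∈ B) : A.card ≤ 4 * B.card := by
  have hsub : A ⊆ Finset.univ.biUnion fun i => A.filter fun a => a * t i ∈ B := by
    intro a ha
    obtain ⟨i, hi⟩ := h a ha
    simp only [Finset.mem_biUnion, Finset.mem_univ, Finset.mem_filter, true_and]
    exact ⟨i, ha, hi⟩
  refine (Finset.card_le_card hsub).trans ?_
  refine Finset.card_biUnion_le.trans ?_
  refine (Finset.sum_le_card_nsmul _ _ B.card fun i _ => ?_).trans (by simp)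
  exact Finset.card_le_card_of_injOn (· * t i) (fun a ha => (Finset.mem_filter.mp ha).2)
    fun a _ b _ hab => mul_right_cancel hab

/-- The symmetrization `A ∪ A⁻¹ ∪ {1}`. -/
def symm (A : Finset (SL₂ F)) : Set (SL₂ F) := {a | a ∈ A ∨ a⁻¹ ∈ A ∨ a = 1}

lemma mem_symm {A : Finset (SL₂ F)} {a : SL₂ F} (h : a ∈ A) : a ∈ symm A := Or.inl h

lemma one_mem_symm (A : Finset (SL₂ F)) : 1 ∈ symm A := Or.inr (Or.inr rfl)

lemma inv_mem_symm {A : Finset (SL₂ F)} {a : SL₂ F} (h : a ∈ symm A) : a⁻¹ ∈ symm A := by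
  rcases h with h | h | h
  · exact Or.inr (Or.inl (by simpa using h))
  · exact Or.inl h
  · exact Or.inr (Or.inr (by simp [h]))

/-- `B` contains every semisimple word of length three in `A ∪ A⁻¹ ∪ {1}`. -/
def ContainsWords (A B : Finset (SL₂ F)) : Prop :=
  ∀ a ∈ symm A, ∀ b ∈ symm A, ∀ c ∈ symm A, Semisimple (a * b * c) → a * b * c ∈ B

lemma ContainsWords.mem {A B : Finset (SL₂ F)} (hB : ContainsWords A B) {a : SL₂ F}
    (ha : a ∈ symm A) (h : Semisimple a) : a ∈ B := by
  simpa using hB a ha 1 (one_mem_symm A) 1 (one_mem_symm A) (by simpa using h)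

lemma ContainsWords.mul_mem {A B : Finset (SL₂ F)} (hB : ContainsWords A B) {a b : SL₂ F}
    (ha : a ∈ symm A) (hb : b ∈ symm A) (h : Semisimple (a * b)) : a * b ∈ B := by
  simpa using hB a ha b hb 1 (one_mem_symm A) (by simpa using h)

lemma semisimple_inv {a : SL₂ F} : Semisimple a⁻¹ ↔ Semisimple a := by
  simp only [Semisimple, tr_inv]

open Classical in
lemma card_le_of_nonsemisimple {A B : Finset (SL₂ F)} (h2 : (2 : F) ≠ 0)
    (hB : ContainsWords A B) {u : SL₂ F} (hu : u ∈ A) (hus : ¬ Semisimple u) :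
    A.card ≤ (A.filter Semisimple).card + 2 * B.card +
      (A.filter fun a => ¬ Semisimple a ∧ a * u = u * a).card := by
  have hsub : A ⊆ (A.filter Semisimple ∪
      (A.filter (fun a => Semisimple (a * u)) ∪ A.filter fun a => Semisimple (a * u⁻¹))) ∪
      A.filter fun a => ¬ Semisimple a ∧ a * u = u * a := by
    intro a ha
    simp only [Finset.mem_union, Finset.mem_filter, ha, true_and]
    by_cases h : Semisimple a
    · simp [h]
    by_cases hc : a * u = u * a
    · simp [h, hc]
    · have := semisimple_mul_or h2 h hus hc
      tauto
  have k1 : (A.filter (fun a => Semisimple (a * u))).card ≤ B.card :=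
    Finset.card_le_card_of_injOn (· * u) (fun a ha => hB.mul_mem
      (mem_symm (Finset.mem_filter.mp ha).1) (mem_symm hu) (Finset.mem_filter.mp ha).2)
      fun a _ b _ hab => mul_right_cancel hab
  have k2 : (A.filter (fun a => Semisimple (a * u⁻¹))).card ≤ B.card :=
    Finset.card_le_card_of_injOn (· * u⁻¹) (fun a ha => hB.mul_mem
      (mem_symm (Finset.mem_filter.mp ha).1) (inv_mem_symm (mem_symm hu))
      (Finset.mem_filter.mp ha).2)
      fun a _ b _ hab => mul_right_cancel hab
  have := Finset.card_le_card hsub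
  have l1 := Finset.card_union_le (A.filter Semisimple ∪
      (A.filter (fun a => Semisimple (a * u)) ∪ A.filter fun a => Semisimple (a * u⁻¹)))
      (A.filter fun a => ¬ Semisimple a ∧ a * u = u * a)
  have l2 := Finset.card_union_le (A.filter Semisimple)
      (A.filter (fun a => Semisimple (a * u)) ∪ A.filter fun a => Semisimple (a * u⁻¹))
  have l3 := Finset.card_union_le (A.filter (fun a => Semisimple (a * u)))
      (A.filter fun a => Semisimple (a * u⁻¹))
  lia

open Classical in
/-- If `A` contains a semisimple `g`, the elements of `A` in a given `±`-unipotent subgroup are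
counted either by translates of `g` or by conjugates of `g` and `g⁻¹`. -/
lemma card_centralizer_le {A B : Finset (SL₂ F)} (h2 : (2 : F) ≠ 0)
    (hB : ContainsWords A B) {u g : SL₂ F} (h1 : u ≠ 1) (h1' : u ≠ -1)
    (hus : ¬ Semisimple u) (hg : g ∈ A) (hgs : Semisimple g) :
    (A.filter fun a => ¬ Semisimple a ∧ a * u = u * a).card ≤ B.card := by
  obtain ⟨δ, hδ, hu⟩ := not_semisimple_iff.mp hus
  by_cases hc : tr (u * g) - δ * tr g = 0
  · refine Finset.card_le_card_of_injOn (· * g) (fun a ha => ?_)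
      fun a _ b _ hab => mul_right_cancel hab
    simp only [Finset.coe_filter, Set.mem_ofPred_eq] at ha
    obtain ⟨ha, has, hau⟩ := ha
    refine hB.mul_mem (mem_symm ha) (mem_symm hg) ?_
    obtain ⟨α, β, hα, -, -, htr⟩ := exists_param h2 h1 h1' hu has hau
    have := htr g
    rw [hc] at this
    rw [Semisimple, this]
    rcases sq_eq_one_iff.mp hα with rfl | rfl
    · simpa [Semisimple] using hgs
    · constructor
      · exact fun h => hgs.2 (by linear_combination -h)
      · exact fun h => hgs.1 (by linear_combination -h)
  · have hug : g * u ≠ u * g := by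
      intro h
      obtain ⟨s, t, hst⟩ := exists_eq_smul_one_add_smul h1 h1' h
      have htr (x : SL₂ F) : tr (g * x) = s * tr x + t * tr (u * x) := by
        simp only [tr, Matrix.SpecialLinearGroup.coe_mul, hst, add_mul, smul_mul_assoc, one_mul,
          Matrix.trace_add, Matrix.trace_smul, smul_eq_mul]
      have e1 := htr 1
      have e2 := htr u
      rw [mul_one, mul_one, tr_one] at e1
      rw [tr_mul_self] at e2
      apply hc
      rw [tr_comm, e1, e2, hu]
      linear_combination 2 * t * hδ
    have aux {a b : SL₂ F} (ha : a * u = u * a) (e : a * g * a⁻¹ = b * g⁻¹ * b⁻¹)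
        (hb : b * u = u * b) : False := by
      have c {x y : SL₂ F} (hx : x * u = u * x) : tr (u * (x * y * x⁻¹)) = tr (u * y) := by
        have : u * (x * y * x⁻¹) = x * (u * y) * x⁻¹ := by
          simp only [← mul_assoc, hx]
        rw [this, tr_conj]
      have k := c (y := g) ha
      rw [e, c hb, tr_mul_inv, hu] at k
      exact hc (mul_left_cancel₀ h2 (by linear_combination -k))
    refine Finset.card_le_card_of_injOn
      (fun a => if tr a = 2 then a * g * a⁻¹ else a * g⁻¹ * a⁻¹) (fun a ha => ?_) ?_
    · simp only [Finset.coe_filter, Set.mem_ofPred_eq] at ha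
      have ha := mem_symm ha.1
      have hg := mem_symm hg
      dsimp only
      split_ifs
      · refine hB _ ha _ hg _ (inv_mem_symm ha) ?_
        rwa [Semisimple, tr_conj]
      · refine hB _ ha _ (inv_mem_symm hg) _ (inv_mem_symm ha) ?_
        rwa [Semisimple, tr_conj, tr_inv]
    · have conj_inj {a b : SL₂ F} (has : ¬ Semisimple a) (hau : a * u = u * a)
          (hbs : ¬ Semisimple b) (hbu : b * u = u * b) (htr : tr a = tr b)
          (e : a * g * a⁻¹ = b * g * b⁻¹) : a = b := by
        have hgc : g * (b⁻¹ * a) = (b⁻¹ * a) * g := by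
          have : b⁻¹ * (a * g * a⁻¹) * a = b⁻¹ * (b * g * b⁻¹) * a := by rw [e]
          simpa [mul_assoc] using this.symm
        have huc : u * (b⁻¹ * a) = (b⁻¹ * a) * u := by
          rw [mul_assoc, hau, ← mul_assoc, ← mul_assoc]
          congr 1
          rw [eq_inv_mul_iff_mul_eq, ← mul_assoc, hbu, mul_inv_cancel_right]
        obtain ⟨α, β, hα, ha, -, ha'⟩ := exists_param h2 h1 h1' hu has hau
        obtain ⟨α', β', hα', hb, -, hb'⟩ := exists_param h2 h1 h1' hu hbs hbu
        obtain rfl : α = α' := mul_left_cancel₀ h2 (by rw [← ha, htr, hb])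
        have h3 : tr (b⁻¹ * a) = 2 := by
          rw [tr_comm, tr_mul_inv, ha', tr_comm u b, hb', tr_mul_self, ha, hb, hu]
          linear_combination 2 * hα - 2 * β * β' * hδ
        by_contra hab
        refine hug (mul_comm_of_centralize (e := b⁻¹ * a) ?_ ?_ hgc huc)
        · intro h
          exact hab (inv_mul_eq_one.mp h).symm
        · intro h
          rw [h] at h3
          have : tr (-1 : SL₂ F) = -2 := by simp [tr]
          rw [this] at h3
          exact mul_ne_zero h2 h2 (by linear_combination -h3)
      intro a ha b hb e
      simp only [Finset.coe_filter, Set.mem_ofPred_eq] at ha hb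
      obtain ⟨-, has, hau⟩ := ha
      obtain ⟨-, hbs, hbu⟩ := hb
      dsimp only at e
      have two {x : SL₂ F} (hx : ¬ Semisimple x) (h : tr x ≠ 2) : tr x = -2 := by
        by_contra h'
        exact hx ⟨h, h'⟩
      split_ifs at e with ta tb tb
      · exact conj_inj has hau hbs hbu (by rw [ta, tb]) e
      · exact (aux hau e hbu).elim
      · exact (aux hbu e.symm hau).elim
      · refine conj_inj has hau hbs hbu (by rw [two has ta, two hbs tb]) ?_
        simpa [mul_assoc] using congrArg (·⁻¹) e

lemma ne_one_of_not_comm {u w : SL₂ F} (h : u * w ≠ w * u) : u ≠ 1 ∧ u ≠ -1 := by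
  constructor <;> rintro rfl <;> simp at h

open Classical in
lemma three_le_card {A B : Finset (SL₂ F)} (h2 : (2 : F) ≠ 0) (hB : ContainsWords A B)
    {u w : SL₂ F} (hu : u ∈ symm A) (hw : w ∈ symm A) (hus : ¬ Semisimple u)
    (h : u * w ≠ w * u) (hs : Semisimple (u * w)) : 3 ≤ B.card := by
  have hsub : {u * w, w * u, w⁻¹ * u⁻¹} ⊆ B := by
    intro x hx
    simp only [Finset.mem_insert, Finset.mem_singleton] at hx
    rcases hx with rfl | rfl | rfl
    · exact hB.mul_mem hu hw hs
    · exact hB.mul_mem hw hu (by rwa [Semisimple, tr_comm])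
    · exact hB.mul_mem (inv_mem_symm hw) (inv_mem_symm hu)
        (by rwa [← mul_inv_rev, semisimple_inv])
  refine le_of_eq_of_le (Finset.card_eq_three.mpr ⟨_, _, _, h, ?_, ?_, rfl⟩).symm
    (Finset.card_le_card hsub)
  · rw [← mul_inv_rev]
    intro e
    have k := tr_mul_self (u * w)
    have k' : u * w * (u * w) = 1 := by
      nth_rewrite 2 [e]
      exact mul_inv_cancel _
    rw [k', tr_one] at k
    have k : (tr (u * w) - 2) * (tr (u * w) + 2) = 0 := by linear_combination -k
    rcases mul_eq_zero.mp k with k | k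
    · exact hs.1 (by linear_combination k)
    · exact hs.2 (by linear_combination k)
  · intro e
    have e1 : u * u = w⁻¹ * w⁻¹ := by
      rw [eq_inv_mul_iff_mul_eq, ← mul_assoc, e, inv_mul_cancel_right]
    have e2 : w * (u * u) = (u * u) * w := by
      rw [e1]
      group
    obtain ⟨δ, hδ, hu⟩ := not_semisimple_iff.mp hus
    have hδ0 : 2 * δ ≠ 0 := mul_ne_zero h2 (by rintro rfl; simp at hδ)
    rw [tr_eq] at hu
    have du := det_eq u
    have sq : (u * u).val = (2 * δ) • u.val - 1 := by
      ext i j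
      fin_cases i <;> fin_cases j <;> simp [Matrix.mul_apply, Fin.sum_univ_two, ← hu]
      · linear_combination -du
      · ring
      · ring
      · linear_combination -du
    refine h (Subtype.ext ?_)
    have e3 := congrArg Subtype.val e2
    rw [Matrix.SpecialLinearGroup.coe_mul, Matrix.SpecialLinearGroup.coe_mul (u * u), sq,
      mul_sub, sub_mul, mul_one, one_mul, mul_smul_comm, smul_mul_assoc, sub_left_inj] at e3
    exact (smul_right_injective _ hδ0 e3).symm

open Classical in
lemma card_le_of_forall_not_semisimple {A B : Finset (SL₂ F)} (h2 : (2 : F) ≠ 0)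
    (hB : ContainsWords A B)
    (h0 : ∀ x ∈ symm A, ∀ y ∈ symm A, Semisimple (x * y) → tr (x * y) = 0)
    (hA : ∀ a ∈ A, ¬ Semisimple a) {u w : SL₂ F} (hu : u ∈ A) (hw : w ∈ A)
    (h : u * w ≠ w * u) : A.card ≤ 4 * B.card := by
  have hB3 : 3 ≤ B.card := by
    rcases semisimple_mul_or h2 (hA u hu) (hA w hw) h with hs | hs
    · exact three_le_card h2 hB (mem_symm hu) (mem_symm hw) (hA u hu) h hs
    · refine three_le_card h2 hB (mem_symm hu) (inv_mem_symm (mem_symm hw)) (hA u hu) ?_ hs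
      exact fun e => h ((Commute.inv_right_iff (a := u) (b := w)).mp e)
  have hempty : A.filter Semisimple = ∅ := Finset.filter_eq_empty_iff.mpr fun {a} ha => hA a ha
  have hcard := card_le_of_nonsemisimple h2 hB hu (hA u hu)
  rw [hempty, Finset.card_empty] at hcard
  suffices (A.filter fun a => ¬ Semisimple a ∧ a * u = u * a).card ≤ 6 by lia
  obtain ⟨h1, h1'⟩ := ne_one_of_not_comm h
  obtain ⟨δ, hδ, hut⟩ := not_semisimple_iff.mp (hA u hu)
  obtain ⟨ε, hε, hwt⟩ := not_semisimple_iff.mp (hA w hw)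
  have hc : tr (u * w) - δ * tr w ≠ 0 := by
    intro hc
    refine h (mul_comm_of_tr hδ hε hut hwt ?_)
    rw [hwt] at hc
    linear_combination hc
  have values {x : SL₂ F} (hx : ¬ Semisimple x) : tr x ∈ ({2, -2} : Finset F) := by
    by_contra hn
    simp only [Finset.mem_insert, Finset.mem_singleton, not_or] at hn
    exact hx hn
  have hle : (({2, -2} : Finset F) ×ˢ ({0, 2, -2} : Finset F)).card ≤ 6 := by
    rw [Finset.card_product]
    exact Nat.mul_le_mul Finset.card_le_two Finset.card_le_three
  refine (Finset.card_le_card_of_injOn (fun a => (tr a, tr (a * w))) ?_ ?_).trans hle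
  · intro a ha
    simp only [Finset.coe_filter, Set.mem_ofPred_eq] at ha
    rw [Finset.mem_coe, Finset.mem_product]
    refine ⟨values ha.2.1, ?_⟩
    by_cases hs : Semisimple (a * w)
    · simp [h0 a (mem_symm ha.1) w (mem_symm hw) hs]
    · exact Finset.mem_insert_of_mem (values hs)
  · intro a ha b hb e
    simp only [Finset.coe_filter, Set.mem_ofPred_eq] at ha hb
    obtain ⟨e1, e2⟩ := Prod.mk.inj e
    obtain ⟨α, β, -, ha1, ha2, ha3⟩ := exists_param h2 h1 h1' hut ha.2.1 ha.2.2
    obtain ⟨α', β', -, hb1, hb2, hb3⟩ := exists_param h2 h1 h1' hut hb.2.1 hb.2.2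
    obtain rfl : α = α' := mul_left_cancel₀ h2 (by rw [← ha1, e1, hb1])
    rw [ha3, hb3] at e2
    obtain rfl : β = β' := mul_right_cancel₀ hc (add_left_cancel e2)
    exact Subtype.ext (ha2.trans hb2.symm)

open Classical in
lemma card_le_of_two_ne_zero {A B : Finset (SL₂ F)} (h2 : (2 : F) ≠ 0)
    (hB : ContainsWords A B) (hA : ∃ x ∈ A, ∃ y ∈ A, x * y ≠ y * x) :
    A.card ≤ 4 * B.card := by
  by_cases h0 : ∀ x ∈ symm A, ∀ y ∈ symm A, Semisimple (x * y) → tr (x * y) = 0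
  swap
  · push Not at h0
    obtain ⟨x, hx, y, hy, hs, h0⟩ := h0
    refine card_le_of_translates A B ![1, x * y, (x * y)⁻¹, 1] fun a ha => ?_
    have ha := mem_symm ha
    by_contra! hn
    have n0 := hn 0
    have n1 := hn 1
    have n2 := hn 2
    simp only [Matrix.cons_val, mul_one] at n0 n1 n2
    refine h0 (tr_eq_zero_of_mul h2 hs (fun h => n0 (hB.mem ha h)) (fun h => n1 ?_)
      (fun h => n2 ?_))
    · rw [← mul_assoc] at h ⊢
      exact hB _ ha _ hx _ hy h
    · rw [mul_inv_rev, ← mul_assoc] at h ⊢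
      exact hB _ ha _ (inv_mem_symm hy) _ (inv_mem_symm hx) h
  by_cases hg : ∃ g ∈ A, Semisimple g
  swap
  · push Not at hg
    obtain ⟨x, hx, y, hy, hxy⟩ := hA
    exact card_le_of_forall_not_semisimple h2 hB h0 hg hx hy hxy
  obtain ⟨g, hg, hgs⟩ := hg
  by_cases hu : ∃ u ∈ A, ¬ Semisimple u ∧ u ≠ 1 ∧ u ≠ -1
  · obtain ⟨u, hu, hus, h1, h1'⟩ := hu
    have k1 := card_le_of_nonsemisimple h2 hB hu hus
    have k2 := card_centralizer_le h2 hB h1 h1' hus hg hgs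
    have k3 : (A.filter Semisimple).card ≤ B.card := Finset.card_le_card fun a ha =>
      hB.mem (mem_symm (Finset.mem_filter.mp ha).1) (Finset.mem_filter.mp ha).2
    lia
  · push Not at hu
    refine card_le_of_translates A B ![1, g, 1, 1] fun a ha => ?_
    by_cases has : Semisimple a
    · exact ⟨0, by simpa using hB.mem (mem_symm ha) has⟩
    · refine ⟨1, hB.mul_mem (mem_symm ha) (mem_symm hg) ?_⟩
      by_cases h1 : a = 1
      · simpa [h1] using hgs
      · rw [hu a ha has h1]
        have : tr (-1 * g) = - tr g := by simp [tr]
        simp only [Matrix.cons_val, Semisimple, this]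
        exact ⟨fun h => hgs.2 (by linear_combination -h), fun h => hgs.1 (by linear_combination -h)⟩

/-- `2 - tr [x, y]`, written in terms of the traces of `x`, `y` and `x * y`. -/
def fricke (x y : SL₂ F) : F :=
  4 - tr x ^ 2 - tr y ^ 2 - tr (x * y) ^ 2 + tr x * tr y * tr (x * y)

/-- If `x`, `y` generate an irreducible subgroup, then `1, x, y, xy` span the matrix algebra, so
no element of `SL₂` is orthogonal to all of them. -/
lemma fricke_eq_zero {a x y : SL₂ F} (h1 : tr a = 0) (hx : tr (a * x) = 0)
    (hy : tr (a * y) = 0) (hxy : tr (a * (x * y)) = 0) : fricke x y = 0 := by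
  have da := det_eq a
  have dx := det_eq x
  have dy := det_eq y
  have e (i j : Fin 2) : (x * y).val i j = x.val i 0 * y.val 0 j + x.val i 1 * y.val 1 j := by
    simp [Matrix.mul_apply, Fin.sum_univ_two]
  rw [tr_mul] at hx hy hxy
  rw [e, e, e, e] at hxy
  rw [fricke, tr_mul, tr_eq, tr_eq]
  rw [tr_eq] at h1
  generalize a.val 0 0 = a0, a.val 0 1 = a1, a.val 1 0 = a2, a.val 1 1 = a3 at *
  generalize x.val 0 0 = x0, x.val 0 1 = x1, x.val 1 0 = x2, x.val 1 1 = x3 at *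
  generalize y.val 0 0 = y0, y.val 0 1 = y1, y.val 1 0 = y2, y.val 1 1 = y3 at *
  obtain rfl : a3 = -a0 := by linear_combination h1
  set z0 := x0 * y0 + x1 * y2 with hz0
  set z1 := x0 * y1 + x1 * y3 with hz1
  set z2 := x2 * y0 + x3 * y2 with hz2
  set z3 := x2 * y1 + x3 * y3 with hz3
  set D := (x0 - x3) * (y2 * z1 - y1 * z2) + x2 * (y1 * (z0 - z3) - (y0 - y3) * z1) +
    x1 * ((y0 - y3) * z2 - y2 * (z0 - z3)) with hD
  have k0 : D * a0 = 0 := by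
    linear_combination (y2 * z1 - y1 * z2) * hx + (z2 * x1 - z1 * x2) * hy +
      (x2 * y1 - x1 * y2) * hxy
  have k1 : D * a1 = 0 := by
    linear_combination (y1 * (z0 - z3) - (y0 - y3) * z1) * hx +
      (z1 * (x0 - x3) - (z0 - z3) * x1) * hy + (x1 * (y0 - y3) - (x0 - x3) * y1) * hxy
  have hK : D = 4 - (x0 + x3) ^ 2 - (y0 + y3) ^ 2 -
      (x0 * y0 + x1 * y2 + (x2 * y1 + x3 * y3)) ^ 2 +
      (x0 + x3) * (y0 + y3) * (x0 * y0 + x1 * y2 + (x2 * y1 + x3 * y3)) := by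
    rw [hD, hz0, hz1, hz2, hz3]
    linear_combination (4 * (y0 * y3 - y1 * y2) - (y0 + y3) ^ 2) * dx + (4 - (x0 + x3) ^ 2) * dy
  rw [← hK]
  linear_combination -D * da - a0 * k0 - a2 * k1

open Classical in
lemma card_le_of_two_eq_zero {A B : Finset (SL₂ F)} (h2 : (2 : F) = 0)
    (hB : ContainsWords A B) (hA : ∃ x ∈ A, ∃ y ∈ A, x * y ≠ y * x) :
    A.card ≤ 4 * B.card := by
  have hs (x : SL₂ F) : Semisimple x ↔ tr x ≠ 0 := by
    simp [Semisimple, h2]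
  by_cases hf : ∀ x ∈ A, ∀ y ∈ A, fricke x y = 0
  swap
  · push Not at hf
    obtain ⟨x, hx, y, hy, hf⟩ := hf
    refine card_le_of_translates A B ![1, x, y, x * y] fun a ha => ?_
    have ha := mem_symm ha
    have hx := mem_symm hx
    have hy := mem_symm hy
    by_contra! hn
    have n0 := hn 0
    have n1 := hn 1
    have n2 := hn 2
    have n3 := hn 3
    simp only [Matrix.cons_val, mul_one] at n0 n1 n2 n3
    refine hf (fricke_eq_zero (a := a) ?_ ?_ ?_ ?_) <;> by_contra h <;> rw [← ne_eq, ← hs] at h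
    · exact n0 (hB.mem ha h)
    · exact n1 (hB.mul_mem ha hx h)
    · exact n2 (hB.mul_mem ha hy h)
    · rw [← mul_assoc] at h n3
      exact n3 (hB _ ha _ hx _ hy h)
  by_cases hg : ∃ g ∈ A, tr g ≠ 0
  · obtain ⟨g, hg, hgs⟩ := hg
    refine card_le_of_translates A B ![1, g, 1, 1] fun a ha => ?_
    by_cases has : tr a = 0
    · refine ⟨1, hB.mul_mem (mem_symm ha) (mem_symm hg) ((hs _).mpr fun h => hgs ?_)⟩
      simp only [Matrix.cons_val] at h
      have k := hf a ha g hg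
      rw [fricke, has, h] at k
      rw [← sq_eq_zero_iff]
      linear_combination 2 * h2 - k
    · exact ⟨0, by simpa using hB.mem (mem_symm ha) ((hs a).mpr has)⟩
  · push Not at hg
    exfalso
    obtain ⟨x, hx, y, hy, hxy⟩ := hA
    have k := hf x hx y hy
    rw [fricke, hg x hx, hg y hy] at k
    have k : tr (x * y) = 0 := by
      rw [← sq_eq_zero_iff]
      linear_combination 2 * h2 - k
    exact hxy (mul_comm_of_tr (ε := 1) (δ := 1) (by ring) (by ring) (by rw [hg x hx, h2, zero_mul])
      (by rw [hg y hy, h2, zero_mul]) (by rw [k, h2, zero_mul]))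

end SLTwo

theorem stmt_13 {F : Type*} [Field F] [DecidableEq F]
    [DecidableEq (Matrix.SpecialLinearGroup (Fin 2) F)]
    (A : Finset (Matrix.SpecialLinearGroup (Fin 2) F))
    (hnab : ¬ ∀ x ∈ Subgroup.closure (A : Set (Matrix.SpecialLinearGroup (Fin 2) F)),
      ∀ y ∈ Subgroup.closure (A : Set (Matrix.SpecialLinearGroup (Fin 2) F)), x * y = y * x) :
    (A.card : ℝ) / 4 ≤
      (((A ∪ A⁻¹ ∪ {1}) * (A ∪ A⁻¹ ∪ {1}) * (A ∪ A⁻¹ ∪ {1})).filter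
        (fun g => Matrix.trace g.val ≠ 2 ∧ Matrix.trace g.val ≠ -2)).card := by
  have hA : ∃ x ∈ A, ∃ y ∈ A, x * y ≠ y * x := by
    by_contra! hcomm
    refine hnab fun x hx y hy => ?_
    have h1 : Subgroup.closure (A : Set (Matrix.SpecialLinearGroup (Fin 2) F)) ≤
        Subgroup.centralizer (A : Set (Matrix.SpecialLinearGroup (Fin 2) F)) := by
      rw [Subgroup.closure_le]
      exact fun a ha => Subgroup.mem_centralizer_iff.mpr fun b hb => hcomm b hb a ha
    rw [← Subgroup.centralizer_closure] at h1
    exact Subgroup.mem_centralizer_iff.mp (h1 hy) x hx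
  set B := ((A ∪ A⁻¹ ∪ {1}) * (A ∪ A⁻¹ ∪ {1}) * (A ∪ A⁻¹ ∪ {1})).filter
    (fun g => Matrix.trace g.val ≠ 2 ∧ Matrix.trace g.val ≠ -2) with hBdef
  have hmem {x} (hx : x ∈ SLTwo.symm A) : x ∈ A ∪ A⁻¹ ∪ {1} := by
    simp only [Finset.mem_union, Finset.mem_inv', Finset.mem_singleton, or_assoc]
    exact hx
  have hB : SLTwo.ContainsWords A B := fun a ha b hb c hc h => Finset.mem_filter.mpr
    ⟨Finset.mul_mem_mul (Finset.mul_mem_mul (hmem ha) (hmem hb)) (hmem hc), h⟩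
  have key : A.card ≤ 4 * B.card := by
    by_cases h2 : (2 : F) = 0
    · exact SLTwo.card_le_of_two_eq_zero h2 hB hA
    · exact SLTwo.card_le_of_two_ne_zero h2 hB hA
  have key : (A.card : ℝ) ≤ 4 * B.card := by exact_mod_cast key
  linarith
end
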